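/- arXiv:1403.5478 — 2 statements merged into one kernel-verified Lean document; each statement's English description precedes it below -/
import Mathlib

section
/- Fix n ∈ ℕ and r ∈ ℝⁿ. Let 𝓡 be the n×2 matrix whose first column is the all-ones vector 1 and whose second column is r, and assume 𝓡ᵀ𝓡 is invertible; let ℋ = 𝓡(𝓡ᵀ𝓡)⁻¹𝓡ᵀ be the OLS hat matrix. Let z ∈ {0,1}ⁿ and y ∈ ℝⁿ, let X = [𝓡 z] be the n×3 matrix obtained by appending z as a third column to 𝓡, and assume XᵀX is invertible (which implies zᵀ(I − ℋ)z ≠ 0). Then the Hodges–Lehmann estimate of a constant additive treatment effect based on the test statistic zᵀẼ_τ with Ẽ_τ = (I − ℋ)(y − τz) — that is, the unique τ ∈ ℝ solving zᵀ(I − ℋ)(y − τz) = 0 — equals the coordinate of the OLS coefficient vector β̂ = (XᵀX)⁻¹Xᵀy corresponding to the column z, i.e. the OLS estimate of the coefficient of z in the linear regression of y on an intercept, r, and z. -/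
open Matrix

/-- **Proposition 2.** With a linear OLS model for the control outcomes (design matrix
`𝓡 = [1 r]`, hat matrix `ℋ = 𝓡(𝓡ᵀ𝓡)⁻¹𝓡ᵀ`), a constant treatment-effect model, and test
statistic `zᵀẼ_τ` where `Ẽ_τ = (I - ℋ)(y - τz)`, the Hodges–Lehmann estimate — the
unique `τ` solving `zᵀ(I - ℋ)(y - τz) = 0` — equals the OLS coefficient of `z` in the
regression of `y` on an intercept, `r`, and `z`. -/
theorem HL_eq_OLS
    {n : ℕ} (r y z : Fin n → ℝ)
    (hz01 : ∀ i, z i = 0 ∨ z i = 1)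
    (R : Matrix (Fin n) (Fin 2) ℝ)
    (hR : R = Matrix.of fun i j => ![1, r i] j)
    (hRinv : IsUnit (Rᵀ * R).det)
    (H : Matrix (Fin n) (Fin n) ℝ)
    (hH : H = R * (Rᵀ * R)⁻¹ * Rᵀ)
    (X : Matrix (Fin n) (Fin 3) ℝ)
    (hX : X = Matrix.of fun i j => ![1, r i, z i] j)
    (hXinv : IsUnit (Xᵀ * X).det) :
    z ⬝ᵥ (1 - H).mulVec z ≠ 0
    ∧ ∀ τ : ℝ, z ⬝ᵥ (1 - H).mulVec (y - τ • z) = 0 ↔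
        τ = ((Xᵀ * X)⁻¹.mulVec (Xᵀ.mulVec y)) 2 := by
  have hXR : ∀ γ : Fin 3 → ℝ, X *ᵥ γ = R *ᵥ ![γ 0, γ 1] + γ 2 • z := by
    intro γ
    ext i
    simp [hX, hR, Matrix.mulVec, dotProduct, Fin.sum_univ_succ]
    ring
  have hXt : ∀ v : Fin n → ℝ, Xᵀ *ᵥ v = ![(Rᵀ *ᵥ v) 0, (Rᵀ *ᵥ v) 1, z ⬝ᵥ v] := by
    intro v
    ext j
    fin_cases j <;> simp [hX, hR, Matrix.mulVec, dotProduct]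
  have hMv : ∀ v : Fin n → ℝ,
      (1 - H) *ᵥ v = v - R *ᵥ ((Rᵀ * R)⁻¹ *ᵥ (Rᵀ *ᵥ v)) := by
    intro v
    rw [Matrix.sub_mulVec, Matrix.one_mulVec, hH, Matrix.mulVec_mulVec, Matrix.mulVec_mulVec,
      Matrix.mul_assoc]
  have hMR : ∀ b : Fin 2 → ℝ, (1 - H) *ᵥ (R *ᵥ b) = 0 := by
    intro b
    rw [hMv, Matrix.mulVec_mulVec b Rᵀ R, Matrix.mulVec_mulVec b,
      Matrix.nonsing_inv_mul _ hRinv, Matrix.one_mulVec, sub_self]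
  have hRM : ∀ v : Fin n → ℝ, Rᵀ *ᵥ ((1 - H) *ᵥ v) = 0 := by
    intro v
    rw [hMv, Matrix.mulVec_sub, Matrix.mulVec_mulVec _ Rᵀ R, Matrix.mulVec_mulVec _ (Rᵀ * R),
      Matrix.mul_nonsing_inv _ hRinv, Matrix.one_mulVec, sub_self]
  have hne : z ⬝ᵥ (1 - H) *ᵥ z ≠ 0 := by
    intro h0
    obtain ⟨b, hb⟩ : ∃ b, b = (Rᵀ * R)⁻¹ *ᵥ (Rᵀ *ᵥ z) := ⟨_, rfl⟩
    have hg : X *ᵥ ![-b 0, -b 1, 1] = (1 - H) *ᵥ z := by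
      rw [hXR, hMv, ← hb]
      have : (![-b 0, -b 1] : Fin 2 → ℝ) = -b := by
        ext j; fin_cases j <;> simp
      simp [this, Matrix.mulVec_neg]
      abel
    have h1 : (Xᵀ * X) *ᵥ ![-b 0, -b 1, 1] = 0 := by
      rw [← Matrix.mulVec_mulVec, hg, hXt, hRM, h0]
      ext j; fin_cases j <;> simp
    have h2 : (![-b 0, -b 1, 1] : Fin 3 → ℝ) = 0 := by
      rw [← Matrix.one_mulVec ![-b 0, -b 1, 1], ← Matrix.nonsing_inv_mul _ hXinv,
        ← Matrix.mulVec_mulVec, h1, Matrix.mulVec_zero]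
    have h3 := congrFun h2 2
    simp at h3
  refine ⟨hne, fun τ => ?_⟩
  obtain ⟨β, hβ⟩ : ∃ β, β = (Xᵀ * X)⁻¹ *ᵥ (Xᵀ *ᵥ y) := ⟨_, rfl⟩
  rw [← hβ]
  have he : Xᵀ *ᵥ (y - X *ᵥ β) = 0 := by
    rw [Matrix.mulVec_sub, Matrix.mulVec_mulVec, hβ, Matrix.mulVec_mulVec _ (Xᵀ * X),
      Matrix.mul_nonsing_inv _ hXinv, Matrix.one_mulVec, sub_self]
  have he' := he
  rw [hXt] at he'
  have e0 := congrFun he' 0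
  have e1 := congrFun he' 1
  have e2 : z ⬝ᵥ (y - X *ᵥ β) = 0 := congrFun he' 2
  have eR : Rᵀ *ᵥ (y - X *ᵥ β) = 0 := by
    ext j; fin_cases j
    · exact e0
    · exact e1
  have hMe : (1 - H) *ᵥ (y - X *ᵥ β) = y - X *ᵥ β := by
    rw [hMv, eR]; simp
  have hy : z ⬝ᵥ (1 - H) *ᵥ y = β 2 * (z ⬝ᵥ (1 - H) *ᵥ z) := by
    have h4 : (1 - H) *ᵥ y = (y - X *ᵥ β) + β 2 • ((1 - H) *ᵥ z) := by
      rw [← hMe, Matrix.mulVec_sub, hXR, Matrix.mulVec_add, hMR, Matrix.mulVec_smul]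
      simp
    rw [h4, dotProduct_add, e2, dotProduct_smul]
    simp
  rw [Matrix.mulVec_sub, Matrix.mulVec_smul, dotProduct_sub, dotProduct_smul, hy, smul_eq_mul,
    ← sub_mul, mul_eq_zero, or_iff_left hne, sub_eq_zero, eq_comm]
end

section
/- Let B be a nonempty finite linearly ordered set (of candidate bandwidths) and α ∈ [0,1]. On a probability space, for each b ∈ B let A_b be the event that the level-α test of hypothesis H_b rejects. Let T ⊆ B be a nonempty downward-closed subset (b ∈ T and b' ≤ b imply b' ∈ T) consisting of the indices whose hypotheses H_b are true, and suppose P(A_b) ≤ α for every b ∈ T. Define the modified procedure that rejects H_b if and only if the event ⋂_{b' ∈ B, b' ≥ b} A_{b'} occurs. Then the probability that the modified procedure rejects H_b for at least one b ∈ T is at most α; that is, the modified procedure strongly controls the family-wise error rate at level α. -/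
open MeasureTheory

/-- The 'testing in order' principle (Rosenbaum 2008, Proposition 1): let `B` be a
nonempty finite linearly ordered set of candidate bandwidths, `A b` the event that the
level-α test of `H_b` rejects, and `T` a nonempty downward-closed set of indices of
true hypotheses with `P(A b) ≤ α` for `b ∈ T`. The modified procedure rejects `H_b`
iff all of the events `A b'` for `b' ≥ b` occur; the probability it rejects some true
`H_b` is at most `α`: it strongly controls the family-wise error rate at level `α`. -/
theorem testing_in_order_fwer
    {Ω B : Type*} [MeasurableSpace Ω] (μ : Measure Ω) [IsProbabilityMeasure μ]
    [Fintype B] [Nonempty B] [LinearOrder B]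
    (α : ℝ) (hα0 : 0 ≤ α) (hα1 : α ≤ 1)
    (A : B → Set Ω) (hAmeas : ∀ b, MeasurableSet (A b))
    (T : Set B) (hTne : T.Nonempty)
    (hTdc : ∀ b ∈ T, ∀ b', b' ≤ b → b' ∈ T)
    (hsize : ∀ b ∈ T, μ (A b) ≤ ENNReal.ofReal α) :
    μ (⋃ b ∈ T, ⋂ b', ⋂ (_ : b ≤ b'), A b') ≤ ENNReal.ofReal α := by
  obtain ⟨m, hmT, hm⟩ := Set.exists_max_image T id T.toFinite hTne
  refine le_trans (measure_mono ?_) (hsize m hmT)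
  intro ω hω
  simp only [Set.mem_iUnion, Set.mem_iInter] at hω
  obtain ⟨b, hb, h⟩ := hω
  exact h m (hm b hb)
end
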